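/- Let Λ > 0, let h₀ ∈ C¹([0,∞)), and let h ∈ C¹([0,∞)×[0,∞)) be the solution of the characteristic problem Dh = −(Λ/3) r (h − h̄), h(0,r) = h₀(r). Then for every (u₁,r₁) ∈ [0,∞)×[0,∞), ∂h/∂r (u₁,r₁) = h₀'(r(0)) · e^{−(2Λ/3)∫₀^{u₁} r(s) ds}, where s ↦ r(s) is the characteristic through (u₁,r₁). -/

import Mathlib

open Real Set

/-- The spherical mean `h̄(u,r) = (1/r) ∫₀^r h(u,s) ds`, with `h̄(u,0) = h(u,0)`. -/
noncomputable def hbar (h : ℝ → ℝ → ℝ) (u r : ℝ) : ℝ :=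
  if r = 0 then h u 0 else (∫ s in (0:ℝ)..r, h u s) / r

/-- Partial derivative in the `u` direction (within `[0,∞)`). -/
noncomputable def pderivU (h : ℝ → ℝ → ℝ) (u r : ℝ) : ℝ :=
  derivWithin (fun u' => h u' r) (Set.Ici 0) u

/-- Partial derivative in the `r` direction (within `[0,∞)`). -/
noncomputable def pderivR (h : ℝ → ℝ → ℝ) (u r : ℝ) : ℝ :=
  derivWithin (fun r' => h u r') (Set.Ici 0) r

/-- `h` solves `Dh = -(Λ/3) r (h - h̄)` on `[0,∞) × [0,∞)`. -/
def IsSol (Λ : ℝ) (h : ℝ → ℝ → ℝ) : Prop :=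
  ∀ u r : ℝ, 0 ≤ u → 0 ≤ r →
    pderivU h u r - (1/2) * (1 - Λ/3 * r^2) * pderivR h u r
      = -(Λ/3) * r * (h u r - hbar h u r)

/-- `χ` is the characteristic through `(u₁,r₁)`: it solves
`χ' = -(1/2)(1 - (Λ/3) χ²)` on `[0,u₁]` with `χ(u₁) = r₁`. -/
def IsChar (Λ u₁ r₁ : ℝ) (χ : ℝ → ℝ) : Prop :=
  χ u₁ = r₁ ∧ ∀ s ∈ Set.Icc 0 u₁, HasDerivAt χ (-(1/2) * (1 - Λ/3 * (χ s)^2)) s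

/-- A solution of the linear equation `y' = K' y` is an exponential of the antiderivative `K`. -/
theorem eq_mul_exp_of_hasDerivAt {y K k : ℝ → ℝ} {a b : ℝ} (hab : a ≤ b)
    (hy : ContinuousOn y (Icc a b)) (hK : ContinuousOn K (Icc a b))
    (hy' : ∀ x ∈ Ioo a b, HasDerivAt y (k x * y x) x)
    (hK' : ∀ x ∈ Ioo a b, HasDerivAt K (k x) x) :
    y b = y a * Real.exp (K b - K a) := by
  rcases hab.eq_or_lt with rfl | hlt
  · simp
  obtain ⟨c, hc, h⟩ := exists_hasDerivAt_eq_slope (fun x => y x * Real.exp (-K x))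
    (fun x => k x * y x * Real.exp (-K x) + y x * (Real.exp (-K x) * -k x)) hlt
    (hy.mul hK.neg.rexp) (fun x hx => (hy' x hx).mul (hK' x hx).neg.exp)
  have h0 : y b * Real.exp (-K b) - y a * Real.exp (-K a) = 0 := by
    have hba : b - a ≠ 0 := (sub_pos.2 hlt).ne'
    have h1 : (y b * Real.exp (-K b) - y a * Real.exp (-K a)) / (b - a) = 0 := by
      rw [← h]; ring
    simpa [hba] using h1
  have h2 : y b = y b * Real.exp (-K b) * Real.exp (K b) := by
    rw [mul_assoc, ← Real.exp_add]; simp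
  rw [h2, sub_eq_zero.1 h0, mul_assoc, ← Real.exp_add]
  congr 2; ring

/-- Differentiation of a primitive of a continuous function under the integral sign. -/
theorem hasDerivAt_integral_primitive {q : ℝ → ℝ → ℝ} (hq : Continuous (Function.uncurry q))
    (a b c x : ℝ) :
    HasDerivAt (fun x => ∫ s in a..b, ∫ y in c..x, q s y) (∫ s in a..b, q s x) x := by
  have hswap : (fun x => ∫ s in a..b, ∫ y in c..x, q s y)
      = fun x => ∫ y in c..x, ∫ s in a..b, q s y := by
    funext x
    refine MeasureTheory.intervalIntegral_intervalIntegral_swap ?_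
    exact (hq.continuousOn.integrableOn_compact (isCompact_uIcc.prod isCompact_uIcc)).mono_set
      (Set.prod_mono uIoc_subset_uIcc uIoc_subset_uIcc)
  have hcont : Continuous fun y => ∫ s in a..b, q s y :=
    intervalIntegral.continuous_parametric_intervalIntegral_of_continuous'
      (f := fun y s => q s y) (hq.comp continuous_swap) a b
  rw [hswap]
  exact intervalIntegral.integral_hasDerivAt_right (hcont.intervalIntegrable _ _)
    hcont.stronglyMeasurable.stronglyMeasurableAtFilter hcont.continuousAt

/-- Denominator of the explicit flow of `r' = (1/2)(1 - k² r²)`. -/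
noncomputable def flowDenom (k τ r : ℝ) : ℝ :=
  Real.cosh (k * τ / 2) + k * r * Real.sinh (k * τ / 2)

/-- The flow of `r' = (1/2)(1 - k² r²)` at time `τ`, starting from `r`. -/
noncomputable def flow (k τ r : ℝ) : ℝ :=
  (k * r * Real.cosh (k * τ / 2) + Real.sinh (k * τ / 2)) / (k * flowDenom k τ r)

/-- The derivative of `flow` with respect to the initial value. -/
noncomputable def flowJac (k τ r : ℝ) : ℝ := 1 / flowDenom k τ r ^ 2

section Flow

variable {k τ r : ℝ}

theorem flowDenom_pos (hk : 0 < k) (hτ : 0 ≤ τ) (hr : 0 ≤ r) : 0 < flowDenom k τ r := by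
  have h1 : 0 ≤ Real.sinh (k * τ / 2) := Real.sinh_nonneg_iff.2 (by positivity)
  have h2 := Real.cosh_pos (k * τ / 2)
  unfold flowDenom
  positivity

theorem flow_nonneg (hk : 0 < k) (hτ : 0 ≤ τ) (hr : 0 ≤ r) : 0 ≤ flow k τ r := by
  have h1 : 0 ≤ Real.sinh (k * τ / 2) := Real.sinh_nonneg_iff.2 (by positivity)
  have h2 := Real.cosh_pos (k * τ / 2)
  have h3 := flowDenom_pos hk hτ hr
  unfold flow
  positivity

theorem flow_pos (hk : 0 < k) (hτ : 0 < τ) (hr : 0 ≤ r) : 0 < flow k τ r := by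
  have h1 : 0 < Real.sinh (k * τ / 2) := Real.sinh_pos_iff.2 (by positivity)
  have h2 := Real.cosh_pos (k * τ / 2)
  have h3 := flowDenom_pos hk hτ.le hr
  unfold flow
  positivity

theorem flow_zero (hk : 0 < k) : flow k 0 r = r := by
  simp [flow, flowDenom, hk.ne']

theorem flowJac_zero : flowJac k 0 r = 1 := by
  simp [flowJac, flowDenom]

theorem hasDerivAt_flow_initial (hk : 0 < k) (hτ : 0 ≤ τ) (hr : 0 ≤ r) :
    HasDerivAt (flow k τ) (flowJac k τ r) r := by
  have hD := flowDenom_pos hk hτ hr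
  have h1 : HasDerivAt (fun r => k * r * Real.cosh (k * τ / 2) + Real.sinh (k * τ / 2))
      (k * Real.cosh (k * τ / 2)) r := by
    simpa using
      (((hasDerivAt_id r).const_mul k).mul_const (Real.cosh (k * τ / 2))).add_const
        (Real.sinh (k * τ / 2))
  have h2 : HasDerivAt (fun r => k * flowDenom k τ r) (k * (k * Real.sinh (k * τ / 2))) r := by
    simpa [flowDenom] using
      ((((hasDerivAt_id r).const_mul k).mul_const _).const_add (Real.cosh (k * τ / 2))).const_mul k
  refine (h1.div h2 (by positivity)).congr_deriv ?_
  have h3 := Real.cosh_sq (k * τ / 2)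
  unfold flowJac
  field_simp
  unfold flowDenom
  linear_combination h3

theorem hasDerivAt_flowDenom_time :
    HasDerivAt (fun τ => flowDenom k τ r)
      (k / 2 * (k * r * Real.cosh (k * τ / 2) + Real.sinh (k * τ / 2))) τ := by
  have h0 : HasDerivAt (fun τ => k * τ / 2) (k / 2) τ := by
    simpa using ((hasDerivAt_id τ).const_mul k).div_const 2
  refine (h0.cosh.add (h0.sinh.const_mul (k * r))).congr_deriv ?_
  ring

theorem hasDerivAt_flow_time (hk : 0 < k) (hτ : 0 ≤ τ) (hr : 0 ≤ r) :
    HasDerivAt (fun τ => flow k τ r) (1 / 2 * (1 - k ^ 2 * flow k τ r ^ 2)) τ := by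
  have hD := flowDenom_pos hk hτ hr
  have h0 : HasDerivAt (fun τ => k * τ / 2) (k / 2) τ := by
    simpa using ((hasDerivAt_id τ).const_mul k).div_const 2
  have h1 := (h0.cosh.const_mul (k * r)).add h0.sinh
  refine (h1.div (hasDerivAt_flowDenom_time.const_mul k) (by positivity)).congr_deriv ?_
  unfold flow
  simp only [Pi.add_apply]
  field_simp
  unfold flowDenom
  ring

theorem hasDerivAt_flowJac_time (hk : 0 < k) (hτ : 0 ≤ τ) (hr : 0 ≤ r) :
    HasDerivAt (fun τ => flowJac k τ r) (-(k ^ 2 * flow k τ r * flowJac k τ r)) τ := by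
  have hD := flowDenom_pos hk hτ hr
  have h1 := (hasDerivAt_flowDenom_time (k := k) (τ := τ) (r := r)).pow 2
  refine ((hasDerivAt_const τ (1 : ℝ)).div h1 (pow_pos hD 2).ne').congr_deriv ?_
  unfold flow flowJac
  simp only [Pi.pow_apply]
  field_simp
  ring

theorem continuous_flowDenom :
    Continuous fun p : ℝ × ℝ => flowDenom k p.1 p.2 := by
  unfold flowDenom
  fun_prop

theorem continuousOn_flow (hk : 0 < k) :
    ContinuousOn (fun p : ℝ × ℝ => flow k p.1 p.2) (Ici 0 ×ˢ Ici 0) := by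
  unfold flow
  refine ContinuousOn.div (by fun_prop) (continuous_flowDenom.const_mul k).continuousOn ?_
  rintro ⟨τ, r⟩ ⟨hτ, hr⟩
  exact (mul_pos hk (flowDenom_pos hk hτ hr)).ne'

theorem continuousOn_flowJac (hk : 0 < k) :
    ContinuousOn (fun p : ℝ × ℝ => flowJac k p.1 p.2) (Ici 0 ×ˢ Ici 0) := by
  unfold flowJac
  refine ContinuousOn.div (by fun_prop) (continuous_flowDenom.pow 2).continuousOn ?_
  rintro ⟨τ, r⟩ ⟨hτ, hr⟩
  exact (pow_pos (flowDenom_pos hk hτ hr) 2).ne'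

end Flow

/-- A characteristic is an orbit of the explicit flow, run backwards from its end point. -/
theorem IsChar.eq_flow {Λ k u₁ r₁ : ℝ} {χ : ℝ → ℝ} (hk : 0 < k) (hΛ : Λ / 3 = k ^ 2)
    (hr₁ : 0 ≤ r₁) (hχ : IsChar Λ u₁ r₁ χ) :
    ∀ s ∈ Icc 0 u₁, χ s = flow k (u₁ - s) r₁ := by
  intro s hs
  have hflow : ∀ t ∈ Icc 0 u₁, HasDerivAt (fun t => flow k (u₁ - t) r₁)
      (-(1 / 2 * (1 - k ^ 2 * flow k (u₁ - t) r₁ ^ 2))) t := fun t ht =>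
    (hasDerivAt_flow_time hk (sub_nonneg.2 ht.2) hr₁).comp_const_sub u₁ t
  have hd : ∀ t ∈ Icc 0 u₁, HasDerivAt (fun t => χ t - flow k (u₁ - t) r₁)
      (k ^ 2 / 2 * (χ t + flow k (u₁ - t) r₁) * (χ t - flow k (u₁ - t) r₁)) t := fun t ht => by
    refine ((hχ.2 t ht).sub (hflow t ht)).congr_deriv ?_
    rw [hΛ]; ring
  have hsub : Icc s u₁ ⊆ Icc 0 u₁ := Icc_subset_Icc_left hs.1
  have hsum : ContinuousOn (fun t => k ^ 2 / 2 * (χ t + flow k (u₁ - t) r₁)) (Icc s u₁) :=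
    fun t ht => (((hχ.2 t (hsub ht)).add (hflow t (hsub ht))).continuousAt.const_mul
      _).continuousWithinAt
  have hext : Continuous (IccExtend hs.2
      ((Icc s u₁).domRestrict fun t => k ^ 2 / 2 * (χ t + flow k (u₁ - t) r₁))) :=
    hsum.domRestrict.Icc_extend'
  have key := eq_mul_exp_of_hasDerivAt (y := fun t => χ t - flow k (u₁ - t) r₁)
    (k := IccExtend hs.2 ((Icc s u₁).domRestrict fun t => k ^ 2 / 2 * (χ t + flow k (u₁ - t) r₁)))
    (K := fun t => ∫ x in s..t, IccExtend hs.2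
      ((Icc s u₁).domRestrict fun t => k ^ 2 / 2 * (χ t + flow k (u₁ - t) r₁)) x) hs.2
    (fun t ht => (hd t (hsub ht)).continuousAt.continuousWithinAt)
    (fun t _ => (hext.integral_hasStrictDerivAt s t).hasDerivAt.continuousAt.continuousWithinAt)
    (fun t ht => by
      rw [IccExtend_of_mem _ _ (Ioo_subset_Icc_self ht)]
      exact hd t (hsub (Ioo_subset_Icc_self ht)))
    (fun t _ => (hext.integral_hasStrictDerivAt s t).hasDerivAt)
  simp only [sub_self, flow_zero hk, hχ.1] at key
  have h0 := (mul_eq_zero.1 key.symm).resolve_right (Real.exp_pos _).ne'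
  linarith

/-- The radial derivative on the quadrant, extended to the plane by clamping the arguments. -/
noncomputable def radialDeriv (h : ℝ → ℝ → ℝ) (u r : ℝ) : ℝ :=
  fderivWithin ℝ (fun p : ℝ × ℝ => h p.1 p.2) (Ici 0 ×ˢ Ici 0) (max u 0, max r 0) (0, 1)

section Regularity

variable {h : ℝ → ℝ → ℝ}
  (hreg : ContDiffOn ℝ 1 (fun p : ℝ × ℝ => h p.1 p.2) (Ici 0 ×ˢ Ici 0))

include hreg

theorem continuous_radialDeriv : Continuous (Function.uncurry (radialDeriv h)) := by
  have h1 := hreg.continuousOn_fderivWithin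
    ((uniqueDiffOn_Ici (0 : ℝ)).prod (uniqueDiffOn_Ici (0 : ℝ))) le_rfl
  have h2 : Continuous fun p : ℝ × ℝ => fderivWithin ℝ (fun p : ℝ × ℝ => h p.1 p.2)
      (Ici 0 ×ˢ Ici 0) (max p.1 0, max p.2 0) :=
    h1.comp_continuous (by fun_prop) fun p => ⟨mem_Ici.2 (le_max_right _ _), mem_Ici.2 (le_max_right _ _)⟩
  exact h2.clm_apply continuous_const

theorem hasDerivWithinAt_radialDeriv {u r : ℝ} (hu : 0 ≤ u) (hr : 0 ≤ r) :
    HasDerivWithinAt (h u) (radialDeriv h u r) (Ici 0) r := by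
  have h1 := (hreg.differentiableOn one_ne_zero (u, r) ⟨hu, hr⟩).hasFDerivWithinAt
  have h2 : HasDerivWithinAt (fun r : ℝ => (u, r)) ((0 : ℝ), (1 : ℝ)) (Ici 0) r :=
    (hasDerivWithinAt_const r _ u).prodMk (hasDerivWithinAt_id r _)
  unfold radialDeriv
  rw [max_eq_left hu, max_eq_left hr]
  exact h1.comp_hasDerivWithinAt r h2 fun x hx => ⟨hu, hx⟩

theorem pderivR_eq_radialDeriv {u r : ℝ} (hu : 0 ≤ u) (hr : 0 ≤ r) :
    pderivR h u r = radialDeriv h u r :=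
  (hasDerivWithinAt_radialDeriv hreg hu hr).derivWithin (uniqueDiffOn_Ici 0 r hr)

/-- The chain rule along a curve, in terms of the two partial derivatives. -/
theorem hasDerivAt_along_curve {γ : ℝ → ℝ} {u γ' : ℝ} (hu : 0 < u) (hγpos : 0 < γ u)
    (hγ : HasDerivAt γ γ' u) :
    HasDerivAt (fun s => h s (γ s)) (pderivU h u (γ u) + γ' * pderivR h u (γ u)) u := by
  have h1 : HasFDerivWithinAt _ _ _ (u, γ u) :=
    (hreg.differentiableOn one_ne_zero (u, γ u) ⟨hu.le, hγpos.le⟩).hasFDerivWithinAt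
  have h2 := h1.hasFDerivAt (prod_mem_nhds (Ici_mem_nhds hu) (Ici_mem_nhds hγpos))
  have hU' : HasDerivWithinAt (fun v : ℝ => (v, γ u)) ((1 : ℝ), (0 : ℝ)) (Ici 0) u :=
    (hasDerivWithinAt_id u _).prodMk (hasDerivWithinAt_const u _ (γ u))
  have h3 := (h1.comp_hasDerivWithinAt u hU' fun x hx => mk_mem_prod hx hγpos.le).derivWithin
    (uniqueDiffOn_Ici 0 u hu.le)
  have h4 := h2.comp_hasDerivAt u ((hasDerivAt_id u).prodMk hγ)
  refine h4.congr_deriv ?_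
  rw [pderivR_eq_radialDeriv hreg hu.le hγpos.le, radialDeriv, max_eq_left hu.le,
    max_eq_left hγpos.le]
  have h5 : pderivU h u (γ u) = _ := h3
  rw [h5, ← smul_eq_mul, ← map_smul, ← map_add]
  simp

/-- `r (h - h̄)` is the integral of `s ∂_r h`. -/
theorem mul_sub_hbar {u r : ℝ} (hu : 0 ≤ u) (hr : 0 ≤ r) :
    r * (h u r - hbar h u r) = ∫ s in (0 : ℝ)..r, s * radialDeriv h u s := by
  rcases hr.eq_or_lt with rfl | hr0
  · simp
  have hc : Continuous (radialDeriv h u) :=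
    (continuous_radialDeriv hreg).uncurry_left u
  have := intervalIntegral.integral_mul_deriv_eq_deriv_mul_of_hasDeriv_right
    (a := 0) (b := r) (u := fun s => s) (u' := fun _ => 1) (v := h u) (v' := radialDeriv h u)
    continuousOn_id
    (by
      rw [uIcc_of_le hr]
      exact fun s hs => (hasDerivWithinAt_radialDeriv hreg hu hs.1).continuousWithinAt.mono
        Icc_subset_Ici_self)
    (fun s _ => hasDerivWithinAt_id s _)
    (fun s hs => by
      rw [min_eq_left hr] at hs
      exact (hasDerivWithinAt_radialDeriv hreg hu hs.1.le).mono
        fun x hx => (hs.1.trans hx).le)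
    intervalIntegrable_const (hc.intervalIntegrable _ _)
  rw [this, hbar, if_neg hr0.ne']
  field_simp
  simp

end Regularity

/-- The backward flow ending at time `T`, with clamped arguments. -/
noncomputable def backFlow (k T s x : ℝ) : ℝ := flow k (max (T - s) 0) (max x 0)

/-- The derivative of `backFlow` in the end point, with clamped arguments. -/
noncomputable def backJac (k T s x : ℝ) : ℝ := flowJac k (max (T - s) 0) (max x 0)

theorem continuous_backFlow {k : ℝ} (hk : 0 < k) (T : ℝ) :
    Continuous (Function.uncurry (backFlow k T)) :=
  (continuousOn_flow hk).comp_continuous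
    (f := fun p : ℝ × ℝ => (max (T - p.1) 0, max p.2 0)) (by fun_prop)
    fun _ => ⟨mem_Ici.2 (le_max_right _ _), mem_Ici.2 (le_max_right _ _)⟩

theorem continuous_backJac {k : ℝ} (hk : 0 < k) (T : ℝ) :
    Continuous (Function.uncurry (backJac k T)) :=
  (continuousOn_flowJac hk).comp_continuous
    (f := fun p : ℝ × ℝ => (max (T - p.1) 0, max p.2 0)) (by fun_prop)
    fun _ => ⟨mem_Ici.2 (le_max_right _ _), mem_Ici.2 (le_max_right _ _)⟩

theorem backFlow_eq {k T s x : ℝ} (hs : s ≤ T) (hx : 0 ≤ x) :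
    backFlow k T s x = flow k (T - s) x := by
  rw [backFlow, max_eq_left (sub_nonneg.2 hs), max_eq_left hx]

theorem backJac_eq {k T s x : ℝ} (hs : s ≤ T) (hx : 0 ≤ x) :
    backJac k T s x = flowJac k (T - s) x := by
  rw [backJac, max_eq_left (sub_nonneg.2 hs), max_eq_left hx]

theorem backFlow_nonneg {k : ℝ} (hk : 0 < k) (T s x : ℝ) : 0 ≤ backFlow k T s x :=
  flow_nonneg hk (le_max_right _ _) (le_max_right _ _)

theorem hasDerivWithinAt_backFlow_endpoint {k T s x : ℝ} (hk : 0 < k) (hs : s ≤ T)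
    (hx : 0 ≤ x) :
    HasDerivWithinAt (backFlow k T s) (backJac k T s x) (Ici 0) x := by
  rw [backJac_eq hs hx]
  exact (hasDerivAt_flow_initial hk (sub_nonneg.2 hs) hx).hasDerivWithinAt.congr
    (fun y hy => backFlow_eq hs hy) (backFlow_eq hs hx)

theorem hasDerivAt_backFlow_time {k T s x : ℝ} (hk : 0 < k) (hs : s < T) (hx : 0 ≤ x) :
    HasDerivAt (fun s => backFlow k T s x)
      (-(1 / 2 * (1 - k ^ 2 * backFlow k T s x ^ 2))) s := by
  have h1 : HasDerivAt (fun s => flow k (T - s) x)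
      (-(1 / 2 * (1 - k ^ 2 * flow k (T - s) x ^ 2))) s :=
    (hasDerivAt_flow_time hk (sub_nonneg.2 hs.le) hx).comp_const_sub T s
  rw [backFlow_eq hs.le hx]
  refine h1.congr_of_eventuallyEq ?_
  filter_upwards [Iio_mem_nhds hs] with t ht
  exact backFlow_eq (le_of_lt ht) hx

theorem hasDerivAt_backJac_time {k T s x : ℝ} (hk : 0 < k) (hs : s < T) (hx : 0 ≤ x) :
    HasDerivAt (fun s => backJac k T s x) (k ^ 2 * backFlow k T s x * backJac k T s x) s := by
  have h1 : HasDerivAt (fun s => flowJac k (T - s) x)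
      (k ^ 2 * flow k (T - s) x * flowJac k (T - s) x) s :=
    ((hasDerivAt_flowJac_time hk (sub_nonneg.2 hs.le) hx).comp_const_sub T s).congr_deriv
      (neg_neg _)
  rw [backFlow_eq hs.le hx, backJac_eq hs.le hx]
  refine h1.congr_of_eventuallyEq ?_
  filter_upwards [Iio_mem_nhds hs] with t ht
  exact backJac_eq (le_of_lt ht) hx

section Representation

variable {h : ℝ → ℝ → ℝ} {k : ℝ}
  (hreg : ContDiffOn ℝ 1 (fun p : ℝ × ℝ => h p.1 p.2) (Ici 0 ×ˢ Ici 0)) (hk : 0 < k)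

include hreg hk

theorem continuous_transported (T : ℝ) :
    Continuous (Function.uncurry fun s x =>
      radialDeriv h s (backFlow k T s x) * backJac k T s x) :=
  ((continuous_radialDeriv hreg).comp
    (continuous_fst.prodMk (continuous_backFlow hk T))).mul (continuous_backJac hk T)

/-- Change of variables along the flow in the radial integral. -/
theorem integral_backFlow {T s x : ℝ} (hs : s ≤ T) (hx : 0 ≤ x) :
    ∫ y in (0 : ℝ)..backFlow k T s x, y * radialDeriv h s y
      = (∫ y in (0 : ℝ)..backFlow k T s 0, y * radialDeriv h s y)
        + ∫ y in (0 : ℝ)..x,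
          backFlow k T s y * (radialDeriv h s (backFlow k T s y) * backJac k T s y) := by
  have hc : Continuous fun y => y * radialDeriv h s y :=
    continuous_id.mul ((continuous_radialDeriv hreg).uncurry_left s)
  have hflow : Continuous (backFlow k T s) :=
    (continuous_backFlow hk T).uncurry_left s
  have hq : Continuous fun y =>
      backFlow k T s y * (radialDeriv h s (backFlow k T s y) * backJac k T s y) :=
    hflow.mul ((continuous_transported hreg hk T).uncurry_left s)
  have hprim : ∀ z, HasDerivAt (fun z => ∫ y in (0 : ℝ)..z, y * radialDeriv h s y)
      (z * radialDeriv h s z) z := fun z => (hc.integral_hasStrictDerivAt 0 z).hasDerivAt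
  have hprimc : Continuous fun z => ∫ y in (0 : ℝ)..z, y * radialDeriv h s y :=
    continuous_iff_continuousAt.2 fun z => (hprim z).continuousAt
  rw [intervalIntegral.integral_eq_sub_of_hasDeriv_right_of_le hx
    (f := fun x => ∫ y in (0 : ℝ)..backFlow k T s x, y * radialDeriv h s y)
    (hprimc.comp hflow).continuousOn ?_ (hq.intervalIntegrable _ _)]
  · ring
  · intro y hy
    refine ((hprim _).comp_hasDerivWithinAt y
      ((hasDerivWithinAt_backFlow_endpoint hk hs hy.1.le).mono
        fun z hz => (hy.1.trans hz).le)).congr_deriv ?_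
    ring

/-- The equation integrated along a characteristic. -/
theorem sub_eq_integral_along_backFlow {Λ T u x : ℝ} (hΛ : Λ / 3 = k ^ 2) (hsol : IsSol Λ h)
    (hu : 0 ≤ u) (huT : u ≤ T) (hx : 0 ≤ x) :
    h u (backFlow k T u x) - h 0 (backFlow k T 0 x)
      = ∫ s in (0 : ℝ)..u,
        -k ^ 2 * ∫ y in (0 : ℝ)..backFlow k T s x, y * radialDeriv h s y := by
  have hflow : Continuous fun s => backFlow k T s x :=
    (continuous_backFlow hk T).uncurry_right x
  have hG : Continuous fun s => ∫ y in (0 : ℝ)..backFlow k T s x, y * radialDeriv h s y :=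
    intervalIntegral.continuous_parametric_intervalIntegral_of_continuous
      (f := fun s y => y * radialDeriv h s y)
      (continuous_snd.mul (continuous_radialDeriv hreg)) hflow
  refine (intervalIntegral.integral_eq_sub_of_hasDeriv_right_of_le hu
    (f := fun s => h s (backFlow k T s x)) ?_ ?_
    ((hG.const_mul _).intervalIntegrable _ _)).symm
  · exact hreg.continuousOn.comp (f := fun s => (s, backFlow k T s x)) (by fun_prop)
      fun s hs => ⟨hs.1, backFlow_nonneg hk _ _ _⟩
  · intro s hs
    have hsT : s < T := hs.2.trans_le huT
    have hpos : 0 < backFlow k T s x := by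
      rw [backFlow_eq hsT.le hx]
      exact flow_pos hk (sub_pos.2 hsT) hx
    refine ((hasDerivAt_along_curve hreg hs.1 hpos
      (hasDerivAt_backFlow_time hk hsT hx)).congr_deriv ?_).hasDerivWithinAt
    have h1 := hsol s _ hs.1.le hpos.le
    rw [hΛ] at h1
    rw [← mul_sub_hbar hreg hs.1.le hpos.le]
    linear_combination h1

/-- The transported radial derivative satisfies a linear Volterra equation. -/
theorem transported_eq_sub_integral {Λ T u x : ℝ} (hΛ : Λ / 3 = k ^ 2) (hsol : IsSol Λ h)
    (hu : 0 ≤ u) (huT : u ≤ T) (hx : 0 ≤ x) :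
    radialDeriv h u (backFlow k T u x) * backJac k T u x
      = radialDeriv h 0 (backFlow k T 0 x) * backJac k T 0 x
        - k ^ 2 * ∫ s in (0 : ℝ)..u,
          backFlow k T s x * (radialDeriv h s (backFlow k T s x) * backJac k T s x) := by
  set q : ℝ → ℝ → ℝ := fun s y =>
    backFlow k T s y * (radialDeriv h s (backFlow k T s y) * backJac k T s y) with hqdef
  have hq : Continuous (Function.uncurry q) :=
    (continuous_backFlow hk T).mul (continuous_transported hreg hk T)
  have hderiv : ∀ v, 0 ≤ v → v ≤ T → HasDerivWithinAt (fun x => h v (backFlow k T v x))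
      (radialDeriv h v (backFlow k T v x) * backJac k T v x) (Ici 0) x := fun v hv hvT =>
    (hasDerivWithinAt_radialDeriv hreg hv (backFlow_nonneg hk _ _ _)).comp x
      (hasDerivWithinAt_backFlow_endpoint hk hvT hx) fun y _ => backFlow_nonneg hk _ _ _
  have hG : Continuous fun s => ∫ y in (0 : ℝ)..backFlow k T s 0, y * radialDeriv h s y :=
    intervalIntegral.continuous_parametric_intervalIntegral_of_continuous
      (f := fun s y => y * radialDeriv h s y)
      (continuous_snd.mul (continuous_radialDeriv hreg))
      ((continuous_backFlow hk T).uncurry_right 0)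
  have hrep : ∀ y ∈ Ici (0 : ℝ), h u (backFlow k T u y)
      = h 0 (backFlow k T 0 y)
        + (-k ^ 2 * (∫ s in (0 : ℝ)..u, ∫ y in (0 : ℝ)..backFlow k T s 0, y * radialDeriv h s y)
          + -k ^ 2 * ∫ s in (0 : ℝ)..u, ∫ z in (0 : ℝ)..y, q s z) := by
    intro y hy
    have hqy : Continuous fun s => ∫ z in (0 : ℝ)..y, q s z :=
      intervalIntegral.continuous_parametric_intervalIntegral_of_continuous' hq 0 y
    rw [← mul_add, ← intervalIntegral.integral_add (hG.intervalIntegrable _ _)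
      (hqy.intervalIntegrable _ _), ← intervalIntegral.integral_const_mul, ← sub_eq_iff_eq_add',
      sub_eq_integral_along_backFlow hreg hk hΛ hsol hu huT hy]
    refine intervalIntegral.integral_congr fun s hs => ?_
    rw [uIcc_of_le hu] at hs
    simp only [integral_backFlow hreg hk (hs.2.trans huT) hy, hqdef]
  have h1 := (hderiv 0 le_rfl (hu.trans huT)).add
    (((hasDerivAt_integral_primitive hq 0 u 0 x).const_mul (-k ^ 2)).const_add
      (-k ^ 2 * ∫ s in (0 : ℝ)..u,
        ∫ y in (0 : ℝ)..backFlow k T s 0, y * radialDeriv h s y)).hasDerivWithinAt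
  rw [(uniqueDiffOn_Ici (0 : ℝ) x hx).eq_deriv _ (hderiv u hu huT)
    (h1.congr hrep (hrep x hx))]
  ring

/-- The radial derivative of a solution, expressed along the explicit flow. -/
theorem radialDeriv_eq_mul_exp {Λ T x : ℝ} (hΛ : Λ / 3 = k ^ 2) (hsol : IsSol Λ h)
    (hT : 0 ≤ T) (hx : 0 ≤ x) :
    radialDeriv h T x = radialDeriv h 0 (backFlow k T 0 x)
      * Real.exp (-(2 * k ^ 2) * ∫ s in (0 : ℝ)..T, backFlow k T s x) := by
  have hflow : Continuous fun s => backFlow k T s x :=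
    (continuous_backFlow hk T).uncurry_right x
  have hjac : Continuous fun s => backJac k T s x :=
    (continuous_backJac hk T).uncurry_right x
  have hW : Continuous fun s => radialDeriv h s (backFlow k T s x) * backJac k T s x :=
    (continuous_transported hreg hk T).uncurry_right x
  have hK : ∀ c t, HasDerivAt (fun t => c * ∫ s in (0 : ℝ)..t, backFlow k T s x)
      (c * backFlow k T t x) t := fun c t =>
    (hflow.integral_hasStrictDerivAt 0 t).hasDerivAt.const_mul c
  have hKc : ∀ c, ContinuousOn (fun t => c * ∫ s in (0 : ℝ)..t, backFlow k T s x) (Icc 0 T) :=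
    fun c t _ => (hK c t).continuousAt.continuousWithinAt
  have hJ := eq_mul_exp_of_hasDerivAt hT hjac.continuousOn (hKc (k ^ 2))
    (fun t ht => hasDerivAt_backJac_time hk ht.2 hx) fun t _ => hK (k ^ 2) t
  have hV := eq_mul_exp_of_hasDerivAt hT hW.continuousOn (hKc (-k ^ 2))
    (fun t ht => by
      have h1 := (((hflow.mul hW).integral_hasStrictDerivAt 0 t).hasDerivAt.const_mul
        (k ^ 2)).const_sub (radialDeriv h 0 (backFlow k T 0 x) * backJac k T 0 x)
      refine (h1.congr_of_eventuallyEq ?_).congr_deriv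
        (by simp only [Pi.mul_apply]; ring)
      filter_upwards [Ioo_mem_nhds ht.1 ht.2] with s hs
      exact transported_eq_sub_integral hreg hk hΛ hsol hs.1.le hs.2.le hx)
    fun t _ => hK (-k ^ 2) t
  have hJT : backJac k T T x = 1 := by rw [backJac_eq le_rfl hx, sub_self, flowJac_zero]
  have hFT : backFlow k T T x = x := by rw [backFlow_eq le_rfl hx, sub_self, flow_zero hk]
  simp only [intervalIntegral.integral_same, mul_zero, sub_zero, hJT, hFT, mul_one] at hJ hV
  set I := ∫ s in (0 : ℝ)..T, backFlow k T s x
  have hJ0 : backJac k T 0 x = Real.exp (-k ^ 2 * I) := by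
    calc backJac k T 0 x
        = backJac k T 0 x * Real.exp (k ^ 2 * I) * Real.exp (-k ^ 2 * I) := by
          rw [mul_assoc, ← Real.exp_add]; simp
      _ = Real.exp (-k ^ 2 * I) := by rw [← hJ, one_mul]
  rw [hV, hJ0, mul_assoc, ← Real.exp_add]
  congr 2
  ring

end Representation

/-- If `h ∈ C¹` solves the characteristic problem with data
`h₀ ∈ C¹([0,∞))`, then for every `(u₁,r₁) ∈ [0,∞)²`,
`∂_r h(u₁,r₁) = h₀'(r(0)) e^{-(2Λ/3)∫₀^{u₁} r(s) ds}` along the characteristic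
`s ↦ r(s)` through `(u₁,r₁)`. -/
theorem radial_derivative_representation
    (Λ : ℝ) (hΛ : 0 < Λ)
    (h₀ : ℝ → ℝ) (h₀reg : ContDiffOn ℝ 1 h₀ (Set.Ici 0))
    (h : ℝ → ℝ → ℝ)
    (hreg : ContDiffOn ℝ 1 (fun p : ℝ × ℝ => h p.1 p.2) (Set.Ici 0 ×ˢ Set.Ici 0))
    (hsol : IsSol Λ h) (hinit : ∀ r, 0 ≤ r → h 0 r = h₀ r)
    (u₁ r₁ : ℝ) (hu₁ : 0 ≤ u₁) (hr₁ : 0 ≤ r₁)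
    (χ : ℝ → ℝ) (hχ : IsChar Λ u₁ r₁ χ)
    (hχnn : ∀ s ∈ Set.Icc 0 u₁, 0 ≤ χ s) :
    pderivR h u₁ r₁
      = derivWithin h₀ (Set.Ici 0) (χ 0)
          * Real.exp (-(2 * Λ / 3) * ∫ s in (0:ℝ)..u₁, χ s) := by
  have hk : 0 < √(Λ / 3) := Real.sqrt_pos.2 (by positivity)
  have hΛk : Λ / 3 = √(Λ / 3) ^ 2 := (Real.sq_sqrt (by positivity)).symm
  have hflow : ∀ s ∈ Icc 0 u₁, backFlow √(Λ / 3) u₁ s r₁ = χ s := fun s hs => by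
    rw [backFlow_eq hs.2 hr₁, hχ.eq_flow hk hΛk hr₁ s hs]
  have h0mem : (0 : ℝ) ∈ Icc 0 u₁ := ⟨le_rfl, hu₁⟩
  have hint : ∫ s in (0 : ℝ)..u₁, backFlow √(Λ / 3) u₁ s r₁ = ∫ s in (0 : ℝ)..u₁, χ s :=
    intervalIntegral.integral_congr fun s hs => hflow s (by rwa [uIcc_of_le hu₁] at hs)
  have hdata : derivWithin h₀ (Ici 0) (χ 0) = radialDeriv h 0 (χ 0) := by
    rw [← pderivR_eq_radialDeriv hreg le_rfl (hχnn 0 h0mem)]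
    exact derivWithin_congr (fun r hr => (hinit r hr).symm) (hinit _ (hχnn 0 h0mem)).symm
  rw [pderivR_eq_radialDeriv hreg hu₁ hr₁, radialDeriv_eq_mul_exp hreg hk hΛk hsol hu₁ hr₁, hint,
    hflow 0 h0mem, hdata, ← hΛk]
  congr 3
  ring
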